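/- arXiv:1601.03436 — 2 statements merged into one kernel-verified Lean document; each statement's English description precedes it below -/
import Mathlib

section
/- Let R be an associative unital ring, M a left R-module that is projective in σ[M], and N a proper fully invariant submodule of M. The following are equivalent: (a) N is semiprime in M; (b) for every m ∈ M, (Rm)·_M(Rm) ≤ N implies m ∈ N; (c) N is an intersection of prime submodules in M. -/
universe u v

section Defs

variable (R : Type u) [Ring R] (M : Type v) [AddCommGroup M] [Module R M]

/-- The product `K ·_M L` of submodules: the sum of all images `f K` over `f : M → L`. -/
def prodM (K L : Submodule R M) : Submodule R M :=
  ⨆ (f : M →ₗ[R] M) (_ : LinearMap.range f ≤ L), K.map f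

/-- A submodule is fully invariant if it is stable under every endomorphism. -/
def IsFullyInvariant (N : Submodule R M) : Prop :=
  ∀ f : M →ₗ[R] M, N.map f ≤ N

/-- A fully invariant submodule `N` is prime in `M` if `K ·_M L ≤ N` implies `K ≤ N` or
`L ≤ N` for all fully invariant submodules `K, L`. -/
def IsPrimeSubmodule (N : Submodule R M) : Prop :=
  IsFullyInvariant R M N ∧
    ∀ K L : Submodule R M, IsFullyInvariant R M K → IsFullyInvariant R M L →
      prodM R M K L ≤ N → K ≤ N ∨ L ≤ N

/-- A fully invariant submodule `N` is semiprime in `M` if `K ·_M K ≤ N` implies `K ≤ N`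
for every fully invariant submodule `K`. -/
def IsSemiprimeSubmodule (N : Submodule R M) : Prop :=
  IsFullyInvariant R M N ∧
    ∀ K : Submodule R M, IsFullyInvariant R M K → prodM R M K K ≤ N → K ≤ N

/-- `M` is a semiprime module if `⊥` is semiprime in `M`. -/
def IsSemiprimeModule : Prop := IsSemiprimeSubmodule R M ⊥

/-- `M` is a prime module if `⊥` is prime in `M`. -/
def IsPrimeModule : Prop := IsPrimeSubmodule R M ⊥

/-- A minimal prime submodule: prime and minimal among prime submodules. -/
def IsMinimalPrimeSubmodule (P : Submodule R M) : Prop :=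
  IsPrimeSubmodule R M P ∧ ∀ Q : Submodule R M, IsPrimeSubmodule R M Q → Q ≤ P → Q = P

/-- `X` is `M`-generated: a homomorphic image of a direct sum of copies of `M`. -/
def IsMGenerated (X : Type v) [AddCommGroup X] [Module R X] : Prop :=
  ∃ (ι : Type v) (f : (ι →₀ M) →ₗ[R] X), Function.Surjective f

/-- `X` belongs to `σ[M]`: isomorphic to a submodule of an `M`-generated module. -/
def InSigmaM (X : Type v) [AddCommGroup X] [Module R X] : Prop :=
  ∃ (Y : Type v) (_ : AddCommGroup Y) (_ : Module R Y),
    IsMGenerated R M Y ∧ ∃ g : X →ₗ[R] Y, Function.Injective g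

/-- `M` is projective in `σ[M]`. -/
def ProjectiveInSigmaM : Prop :=
  ∀ (A B : Type v) [AddCommGroup A] [Module R A] [AddCommGroup B] [Module R B],
    InSigmaM R M A → InSigmaM R M B →
      ∀ g : A →ₗ[R] B, Function.Surjective g →
        ∀ h : M →ₗ[R] B, ∃ f : M →ₗ[R] A, g ∘ₗ f = h

/-- `N` is essential in `M`. -/
def IsEssentialSub (N : Submodule R M) : Prop :=
  ∀ L : Submodule R M, L ≠ ⊥ → N ⊓ L ≠ ⊥

/-- `M` has finite uniform dimension: no infinite independent family of nonzero submodules. -/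
def HasFinUdim : Prop :=
  ¬ ∃ f : ℕ → Submodule R M, (∀ n, f n ≠ ⊥) ∧
      ∀ n, Disjoint (f n) (⨆ (m) (_ : m ≠ n), f m)

/-- A left annihilator in `M`: an intersection `⋂_{f ∈ X} ker f` with `X ⊆ End_R(M)`. -/
def IsLeftAnnihilatorSub (N : Submodule R M) : Prop :=
  ∃ X : Set (M →ₗ[R] M), N = ⨅ f ∈ X, LinearMap.ker f

/-- ACC on left annihilators. -/
def AccLeftAnnihilators : Prop :=
  ∀ a : ℕ → Submodule R M, (∀ n, IsLeftAnnihilatorSub R M (a n)) → Monotone a →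
    ∃ n, ∀ m, n ≤ m → a m = a n

/-- `M` is a Goldie module: ACC on left annihilators and finite uniform dimension. -/
def IsGoldieModule : Prop := AccLeftAnnihilators R M ∧ HasFinUdim R M

/-- `Ann_M(K) = ⋂ { ker f | f ∈ Hom_R(M, K) }`. -/
def annM (K : Submodule R M) : Submodule R M :=
  ⨅ (f : M →ₗ[R] M) (_ : LinearMap.range f ≤ K), LinearMap.ker f

/-- `N` is an annihilator submodule: `N = Ann_M(K)` for some nonzero submodule `K`. -/
def IsAnnihilatorSub (N : Submodule R M) : Prop :=
  ∃ K : Submodule R M, K ≠ ⊥ ∧ N = annM R M K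

/-- A submodule `U` is uniform: nonzero and every nonzero submodule of `U` is essential in `U`. -/
def IsUniformSub (U : Submodule R M) : Prop :=
  U ≠ ⊥ ∧ ∀ A B : Submodule R M, A ≤ U → B ≤ U → A ≠ ⊥ → B ≠ ⊥ → A ⊓ B ≠ ⊥

/-- A submodule `U` is monoform: nonzero and every nonzero homomorphism `L → U` from a
submodule `L ≤ U` is injective. -/
def IsMonoformSub (U : Submodule R M) : Prop :=
  U ≠ ⊥ ∧ ∀ L : Submodule R M, L ≤ U → ∀ f : L →ₗ[R] U, f ≠ 0 → Function.Injective f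

/-- `M` has enough monoforms: every nonzero submodule contains a monoform submodule. -/
def HasEnoughMonoforms : Prop :=
  ∀ N : Submodule R M, N ≠ ⊥ → ∃ U : Submodule R M, U ≤ N ∧ IsMonoformSub R M U

/-- `M` is weakly compressible. -/
def WeaklyCompressible : Prop :=
  ∀ N : Submodule R M, N ≠ ⊥ → ∃ f : M →ₗ[R] M, LinearMap.range f ≤ N ∧ f ∘ₗ f ≠ 0

/-- `M` is retractable: `Hom_R(M, N) ≠ 0` for every nonzero submodule `N`. -/
def Retractable : Prop :=
  ∀ N : Submodule R M, N ≠ ⊥ → ∃ f : M →ₗ[R] M, LinearMap.range f ≤ N ∧ f ≠ 0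

/-- Powers of a fully invariant submodule: `J^0 = ⊥`, `J^1 = J`, `J^(m+1) = J ·_M J^m`. -/
def fipow (J : Submodule R M) : ℕ → Submodule R M
  | 0 => ⊥
  | 1 => J
  | n + 2 => prodM R M J (fipow J (n + 1))

end Defs

section RingDefs

variable (S : Type*) [Ring S]

/-- A ring is semiprime: no nonzero two-sided ideal squares to zero. -/
def IsSemiprimeRing : Prop :=
  ∀ I : TwoSidedIdeal S, (∀ a ∈ I, ∀ b ∈ I, a * b = 0) → I = ⊥

/-- A ring is prime: `I · J = 0` forces `I = 0` or `J = 0` for two-sided ideals. -/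
def IsPrimeRing : Prop :=
  ∀ I J : TwoSidedIdeal S, (∀ a ∈ I, ∀ b ∈ J, a * b = 0) → I = ⊥ ∨ J = ⊥

/-- A right annihilator subset of `S`: `{ s | X s = 0 }` for some `X ⊆ S`. -/
def IsRightAnnihilatorSet (T : Set S) : Prop :=
  ∃ X : Set S, T = {s : S | ∀ x ∈ X, x * s = 0}

/-- ACC on right annihilators of the ring `S`. -/
def AccRightAnnihilators : Prop :=
  ∀ a : ℕ → Set S, (∀ n, IsRightAnnihilatorSet S (a n)) → (∀ n, a n ⊆ a (n + 1)) →
    ∃ n, ∀ m, n ≤ m → a m = a n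

/-- `S` is a right Goldie ring: ACC on right annihilators and finite uniform dimension
as a right `S`-module. -/
def IsRightGoldieRing : Prop :=
  AccRightAnnihilators S ∧ HasFinUdim Sᵐᵒᵖ S

end RingDefs

section Helpers

variable {R : Type u} [Ring R] {M : Type v} [AddCommGroup M] [Module R M]

theorem apply_mem_prodM {K L : Submodule R M} {f : M →ₗ[R] M} (hf : ∀ x, f x ∈ L) {k : M}
    (hk : k ∈ K) : f k ∈ prodM R M K L :=
  (le_iSup₂_of_le (f := fun (f : M →ₗ[R] M) (_ : LinearMap.range f ≤ L) => K.map f) f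
    (by rintro _ ⟨x, rfl⟩; exact hf x) le_rfl) (Submodule.mem_map_of_mem hk)

theorem prodM_le {K L N : Submodule R M} :
    prodM R M K L ≤ N ↔ ∀ f : M →ₗ[R] M, (∀ x, f x ∈ L) → ∀ k ∈ K, f k ∈ N := by
  refine ⟨fun h f hf k hk => h (apply_mem_prodM hf hk), fun h => iSup₂_le fun f hf => ?_⟩
  rintro _ ⟨k, hk, rfl⟩
  exact h f (fun x => hf ⟨x, rfl⟩) k hk

theorem prodM_mono {K K' L L' : Submodule R M} (hK : K ≤ K') (hL : L ≤ L') :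
    prodM R M K L ≤ prodM R M K' L' :=
  prodM_le.2 fun _ hf _ hk => apply_mem_prodM (fun x => hL (hf x)) (hK hk)

theorem prodM_le_right (K L : Submodule R M) : prodM R M K L ≤ L :=
  prodM_le.2 fun _ hf k _ => hf k

theorem IsFullyInvariant.apply_mem {N : Submodule R M} (h : IsFullyInvariant R M N)
    (f : M →ₗ[R] M) {x : M} (hx : x ∈ N) : f x ∈ N :=
  h f (Submodule.mem_map_of_mem hx)

theorem IsFullyInvariant.sup {K L : Submodule R M} (hK : IsFullyInvariant R M K)
    (hL : IsFullyInvariant R M L) : IsFullyInvariant R M (K ⊔ L) := fun f => by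
  rw [Submodule.map_sup]
  exact sup_le_sup (hK f) (hL f)

theorem IsFullyInvariant.sSup {S : Set (Submodule R M)}
    (hS : ∀ K ∈ S, IsFullyInvariant R M K) : IsFullyInvariant R M (sSup S) := fun f => by
  rw [sSup_eq_iSup, Submodule.map_iSup]
  refine iSup_le fun K => ?_
  rw [Submodule.map_iSup]
  exact iSup_le fun hK => (hS K hK f).trans (le_iSup₂_of_le K hK le_rfl)

theorem isFullyInvariant_iSup_map (K : Submodule R M) :
    IsFullyInvariant R M (⨆ f : M →ₗ[R] M, K.map f) := fun g => by
  rw [Submodule.map_iSup]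
  refine iSup_le fun f => ?_
  rw [← Submodule.map_comp]
  exact le_iSup (fun f : M →ₗ[R] M => K.map f) (g ∘ₗ f)

theorem inSigmaM_submodule {Y : Type v} [AddCommGroup Y] [Module R Y] (hY : IsMGenerated R M Y)
    (A : Submodule R Y) : InSigmaM R M A :=
  ⟨Y, _, _, hY, A.subtype, A.injective_subtype⟩

theorem isMGenerated_finsupp (ι : Type v) : IsMGenerated R M (ι →₀ M) :=
  ⟨ι, LinearMap.id, Function.surjective_id⟩

theorem isMGenerated_self : IsMGenerated R M M :=
  ⟨PUnit, Finsupp.lapply PUnit.unit, fun x => ⟨Finsupp.single PUnit.unit x, by simp⟩⟩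

/-- If `M` is projective in `σ[M]`, then an endomorphism into `∑ i, f i (A i)` decomposes
pointwise as a finite sum of `f i` applied to values of homomorphisms `M → A i`. -/
theorem ProjectiveInSigmaM.exists_decomposition (hproj : ProjectiveInSigmaM R M) {ι : Type v}
    (A : ι → Submodule R M) (f : ι → M →ₗ[R] M) (g : M →ₗ[R] M)
    (hg : ∀ x, g x ∈ ⨆ i, (A i).map (f i)) :
    ∃ l : M →ₗ[R] (ι →₀ M), (∀ x i, l x i ∈ A i) ∧
      ∀ x, g x = (l x).sum fun i y => f i y := by
  let B : Submodule R (ι →₀ M) := ⨅ i, (A i).comap (Finsupp.lapply i)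
  let s : B →ₗ[R] M := (Finsupp.lsum ℕ f) ∘ₗ B.subtype
  have hs : ⨆ i, (A i).map (f i) ≤ LinearMap.range s := by
    refine iSup_le fun i => ?_
    rintro _ ⟨a, ha, rfl⟩
    refine ⟨⟨Finsupp.single i a, ?_⟩, by simp [s]⟩
    refine (Submodule.mem_iInf _).2 fun j => ?_
    by_cases h : i = j
    · subst h
      simpa using ha
    · simp [Finsupp.single_eq_of_ne' h]
  obtain ⟨l, hl⟩ := hproj B (LinearMap.range s)
    (inSigmaM_submodule (isMGenerated_finsupp ι) B) (inSigmaM_submodule isMGenerated_self _)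
    s.rangeRestrict s.surjective_rangeRestrict (g.codRestrict _ fun x => hs (hg x))
  refine ⟨B.subtype ∘ₗ l, fun x i => (Submodule.mem_iInf _).1 (l x).2 i, fun x => ?_⟩
  exact (congrArg Subtype.val (LinearMap.congr_fun hl x)).symm

theorem prodM_sup_right_le (hproj : ProjectiveInSigmaM R M) (K L P : Submodule R M) :
    prodM R M K (L ⊔ P) ≤ prodM R M K L ⊔ prodM R M K P := by
  refine prodM_le.2 fun g hg k hk => ?_
  obtain ⟨l, hl, hgl⟩ := hproj.exists_decomposition
    (fun i : ULift.{v} Bool => bif i.down then L else P) (fun _ => LinearMap.id) g (fun x => by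
      simpa [iSup_ulift, iSup_bool_eq] using hg x)
  rw [hgl]
  refine Submodule.sum_mem _ fun i _ => ?_
  have h := apply_mem_prodM (K := K) (f := Finsupp.lapply i ∘ₗ l) (fun x => hl x i) hk
  rcases i with ⟨_ | _⟩
  · exact Submodule.mem_sup_right h
  · exact Submodule.mem_sup_left h

theorem prodM_sup_sup_le (hproj : ProjectiveInSigmaM R M) {K L P : Submodule R M}
    (hP : IsFullyInvariant R M P) (h : prodM R M K L ≤ P) :
    prodM R M (K ⊔ P) (L ⊔ P) ≤ P := by
  refine prodM_le.2 fun g hg x hx => ?_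
  obtain ⟨k, hk, p, hp, rfl⟩ := Submodule.mem_sup.1 hx
  rw [map_add]
  refine P.add_mem ?_ (hP.apply_mem g hp)
  exact (prodM_sup_right_le hproj K L P).trans (sup_le h (prodM_le_right K P))
    (apply_mem_prodM hg hk)

theorem IsSemiprimeSubmodule.mem_of_prodM_span_le (hproj : ProjectiveInSigmaM R M)
    {N : Submodule R M} (hN : IsSemiprimeSubmodule R M N) {m : M}
    (hm : prodM R M (Submodule.span R {m}) (Submodule.span R {m}) ≤ N) : m ∈ N := by
  have hm' : m ∈ ⨆ f : M →ₗ[R] M, (Submodule.span R {m}).map f :=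
    (le_iSup (fun f : M →ₗ[R] M => (Submodule.span R {m}).map f) LinearMap.id)
      ⟨m, Submodule.mem_span_singleton_self m, rfl⟩
  refine hN.2 _ (isFullyInvariant_iSup_map (Submodule.span R {m})) ?_ hm'
  refine prodM_le.2 fun g hg k hk => ?_
  obtain ⟨l, hl, hgl⟩ := hproj.exists_decomposition
    (fun _ : M →ₗ[R] M => Submodule.span R {m}) (fun f => f) g hg
  suffices h : (⨆ f : M →ₗ[R] M, (Submodule.span R {m}).map f) ≤ N.comap g from h hk
  refine iSup_le fun h => ?_
  rintro _ ⟨y, hy, rfl⟩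
  rw [Submodule.mem_comap, hgl]
  refine Submodule.sum_mem _ fun i _ => hN.1.apply_mem i (hm ?_)
  exact apply_mem_prodM (f := Finsupp.lapply i ∘ₗ l ∘ₗ h) (fun x => hl (h x) i) hy

theorem isSemiprimeSubmodule_iff_forall_mem (hproj : ProjectiveInSigmaM R M)
    {N : Submodule R M} (hN : IsFullyInvariant R M N) :
    IsSemiprimeSubmodule R M N ↔
      ∀ m : M, prodM R M (Submodule.span R {m}) (Submodule.span R {m}) ≤ N → m ∈ N := by
  refine ⟨fun h m hm => h.mem_of_prodM_span_le hproj hm, fun h => ⟨hN, fun K _ hK m hm => ?_⟩⟩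
  have hle : Submodule.span R {m} ≤ K := (Submodule.span_singleton_le_iff_mem m K).2 hm
  exact h m ((prodM_mono hle hle).trans hK)

/-- A fully invariant submodule that is maximal among those avoiding a sequence `a` with
`a (n + 1) ∈ (R a n) ·_M (R a n)` is prime. -/
theorem isPrimeSubmodule_of_maximal (hproj : ProjectiveInSigmaM R M) {N P : Submodule R M}
    {a : ℕ → M}
    (ha : ∀ n, a (n + 1) ∈ prodM R M (Submodule.span R {a n}) (Submodule.span R {a n}))
    (hP : Maximal (fun Q => IsFullyInvariant R M Q ∧ N ≤ Q ∧ ∀ n, a n ∉ Q) P) :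
    IsPrimeSubmodule R M P := by
  refine ⟨hP.prop.1, fun K L hK hL hKL => ?_⟩
  by_contra! hcon
  have hanti : Antitone fun n => Submodule.span R {a n} := antitone_nat_of_succ_le fun n =>
    (Submodule.span_singleton_le_iff_mem _ _).2 (prodM_le_right _ _ (ha n))
  have key : ∀ {K : Submodule R M}, IsFullyInvariant R M K → ¬ K ≤ P →
      ∃ n, Submodule.span R {a n} ≤ K ⊔ P := by
    intro K hK hKP
    by_contra! hn
    refine hKP (le_sup_left.trans (hP.le_of_ge ⟨hK.sup hP.prop.1,
      hP.prop.2.1.trans le_sup_right, fun n h => hn n ?_⟩ le_sup_right))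
    exact (Submodule.span_singleton_le_iff_mem _ _).2 h
  obtain ⟨i, hi⟩ := key hK hcon.1
  obtain ⟨j, hj⟩ := key hL hcon.2
  refine hP.prop.2.2 (max i j + 1) (prodM_sup_sup_le hproj hP.prop.1 hKL ?_)
  exact prodM_mono ((hanti (le_max_left i j)).trans hi) ((hanti (le_max_right i j)).trans hj)
    (ha _)

theorem exists_maximal_avoiding {N : Submodule R M} (hN : IsFullyInvariant R M N) {a : ℕ → M}
    (ha : ∀ n, a n ∉ N) :
    ∃ P, Maximal (fun Q => IsFullyInvariant R M Q ∧ N ≤ Q ∧ ∀ n, a n ∉ Q) P := by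
  obtain ⟨P, -, hP⟩ := zorn_le_nonempty₀
    {Q : Submodule R M | IsFullyInvariant R M Q ∧ N ≤ Q ∧ ∀ n, a n ∉ Q}
    (fun c hc hchain Q hQ => by
      refine ⟨sSup c, ⟨IsFullyInvariant.sSup fun K hK => (hc hK).1,
        (hc hQ).2.1.trans (le_sSup hQ), fun n hn => ?_⟩, fun K hK => le_sSup hK⟩
      obtain ⟨K, hK, hnK⟩ := (Submodule.mem_sSup_of_directed ⟨Q, hQ⟩ hchain.directedOn).1 hn
      exact (hc hK).2.2 n hnK)
    N ⟨hN, le_rfl, ha⟩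
  exact ⟨P, hP⟩

theorem IsSemiprimeSubmodule.exists_prime (hproj : ProjectiveInSigmaM R M) {N : Submodule R M}
    (hN : IsSemiprimeSubmodule R M N) {m : M} (hm : m ∉ N) :
    ∃ P, IsPrimeSubmodule R M P ∧ N ≤ P ∧ m ∉ P := by
  have step : ∀ x : {x : M // x ∉ N}, ∃ y : {y : M // y ∉ N},
      y.1 ∈ prodM R M (Submodule.span R {x.1}) (Submodule.span R {x.1}) := fun x => by
    obtain ⟨y, hy, hyN⟩ := SetLike.not_le_iff_exists.1 (mt (hN.mem_of_prodM_span_le hproj) x.2)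
    exact ⟨⟨y, hyN⟩, hy⟩
  choose next hnext using step
  let b : ℕ → {x : M // x ∉ N} := fun n => next^[n] ⟨m, hm⟩
  obtain ⟨P, hP⟩ := exists_maximal_avoiding hN.1 (a := fun n => (b n).1) fun n => (b n).2
  refine ⟨P, isPrimeSubmodule_of_maximal hproj (fun n => ?_) hP, hP.prop.2.1, hP.prop.2.2 0⟩
  simp only [b, Function.iterate_succ_apply']
  exact hnext _

theorem isSemiprimeSubmodule_iff_eq_sInf (hproj : ProjectiveInSigmaM R M)
    {N : Submodule R M} (hN : IsFullyInvariant R M N) :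
    IsSemiprimeSubmodule R M N ↔
      ∃ Ps : Set (Submodule R M), (∀ P ∈ Ps, IsPrimeSubmodule R M P) ∧ N = sInf Ps := by
  constructor
  · refine fun h => ⟨{P | IsPrimeSubmodule R M P ∧ N ≤ P}, fun P hP => hP.1,
      le_antisymm (le_sInf fun P hP => hP.2) fun m hm => ?_⟩
    by_contra hmN
    obtain ⟨P, hP, hNP, hmP⟩ := h.exists_prime hproj hmN
    exact hmP ((Submodule.mem_sInf.1 hm) P ⟨hP, hNP⟩)
  · rintro ⟨Ps, hPs, rfl⟩
    refine ⟨hN, fun K hK hKK => le_sInf fun P hP => ?_⟩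
    exact or_self_iff.1 ((hPs P hP).2 K K hK hK (hKK.trans (sInf_le hP)))

end Helpers

/-- For `M` projective in `σ[M]` and `N` a proper fully invariant submodule:
`N` semiprime iff (`(Rm)·_M(Rm) ≤ N → m ∈ N`) iff `N` is an intersection of prime
submodules. -/
theorem stmt8 (R : Type u) [Ring R] (M : Type v) [AddCommGroup M] [Module R M]
    (hproj : ProjectiveInSigmaM R M) (N : Submodule R M)
    (hNproper : N ≠ ⊤) (hNfi : IsFullyInvariant R M N) :
    (IsSemiprimeSubmodule R M N ↔
      ∀ m : M, prodM R M (Submodule.span R {m}) (Submodule.span R {m}) ≤ N → m ∈ N) ∧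
    (IsSemiprimeSubmodule R M N ↔
      ∃ Ps : Set (Submodule R M),
        (∀ P ∈ Ps, IsPrimeSubmodule R M P) ∧ N = sInf Ps) := by
  exact ⟨isSemiprimeSubmodule_iff_forall_mem hproj hNfi,
    isSemiprimeSubmodule_iff_eq_sInf hproj hNfi⟩
end

section
/- Let R be an associative unital ring, M a left R-module that is projective in σ[M] and semiprime, and N ≤ M a submodule. The following are equivalent: (a) N is a maximal annihilator submodule (maximal with respect to inclusion among annihilator submodules of M); (b) N is an annihilator submodule and a minimal prime submodule of M; (c) N is prime in M and N is an annihilator submodule. -/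
universe u v

section Annihilators

variable {R : Type u} [Ring R] {M : Type v} [AddCommGroup M] [Module R M]

theorem mem_annM {K : Submodule R M} {x : M} :
    x ∈ annM R M K ↔ ∀ f : M →ₗ[R] M, LinearMap.range f ≤ K → f x = 0 := by
  simp [annM, Submodule.mem_iInf]

theorem annM_anti {K L : Submodule R M} (h : K ≤ L) : annM R M L ≤ annM R M K :=
  fun _ hx => mem_annM.2 fun f hf => mem_annM.1 hx f (hf.trans h)

theorem isFullyInvariant_annM (K : Submodule R M) : IsFullyInvariant R M (annM R M K) := by
  rintro g _ ⟨x, hx, rfl⟩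
  exact mem_annM.2 fun f hf =>
    mem_annM.1 hx (f ∘ₗ g) ((LinearMap.range_comp_le_range g f).trans hf)

theorem prodM_le_iff {K L N : Submodule R M} :
    prodM R M K L ≤ N ↔ ∀ f : M →ₗ[R] M, LinearMap.range f ≤ L → K.map f ≤ N := by
  simp [prodM]

theorem prodM_eq_bot_iff {K L : Submodule R M} : prodM R M K L = ⊥ ↔ K ≤ annM R M L := by
  rw [← le_bot_iff, prodM_le_iff]
  constructor
  · exact fun h x hx => mem_annM.2 fun f hf =>
      (Submodule.mem_bot R).1 (h f hf (Submodule.mem_map_of_mem hx))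
  · rintro h f hf _ ⟨x, hx, rfl⟩
    exact (Submodule.mem_bot R).2 (mem_annM.1 (h hx) f hf)

theorem prodM_le_inf {K L : Submodule R M} (hK : IsFullyInvariant R M K) :
    prodM R M K L ≤ K ⊓ L :=
  prodM_le_iff.2 fun f hf => le_inf (hK f) (LinearMap.map_le_range.trans hf)

theorem IsFullyInvariant.inf {K L : Submodule R M} (hK : IsFullyInvariant R M K)
    (hL : IsFullyInvariant R M L) : IsFullyInvariant R M (K ⊓ L) :=
  fun f => (Submodule.map_inf_le f).trans (inf_le_inf (hK f) (hL f))

theorem IsFullyInvariant.prodM {K L : Submodule R M} (hL : IsFullyInvariant R M L) :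
    IsFullyInvariant R M (prodM R M K L) := by
  intro g
  rw [Submodule.map_le_iff_le_comap, prodM_le_iff]
  intro f hf
  rw [← Submodule.map_le_iff_le_comap, ← Submodule.map_comp]
  refine prodM_le_iff.1 le_rfl (g ∘ₗ f) ?_
  rw [LinearMap.range_comp]
  exact (Submodule.map_mono hf).trans (hL g)

/-- In a semiprime module, fully invariant submodules with zero product meet trivially. -/
theorem IsSemiprimeModule.inf_eq_bot (hsemi : IsSemiprimeModule R M) {K L : Submodule R M}
    (hK : IsFullyInvariant R M K) (hL : IsFullyInvariant R M L) (h : K ≤ annM R M L) :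
    K ⊓ L = ⊥ :=
  le_bot_iff.1 (hsemi.2 _ (hK.inf hL)
    ((prodM_mono inf_le_left inf_le_right).trans (prodM_eq_bot_iff.2 h).le))

/-- The smallest fully invariant submodule containing `K`. -/
def fullyInvariantHull (K : Submodule R M) : Submodule R M :=
  ⨆ g : M →ₗ[R] M, K.map g

theorem le_fullyInvariantHull (K : Submodule R M) : K ≤ fullyInvariantHull K := by
  simpa [fullyInvariantHull] using le_iSup (fun g : M →ₗ[R] M => K.map g) LinearMap.id

theorem isFullyInvariant_fullyInvariantHull (K : Submodule R M) :
    IsFullyInvariant R M (fullyInvariantHull K) := by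
  intro f
  rw [fullyInvariantHull, Submodule.map_iSup]
  refine iSup_le fun g => ?_
  rw [← Submodule.map_comp]
  exact le_iSup (fun g : M →ₗ[R] M => K.map g) (f ∘ₗ g)

theorem inSigmaM_of_injective {X : Type v} [AddCommGroup X] [Module R X] {ι : Type v}
    (g : X →ₗ[R] ι →₀ M) (hg : Function.Injective g) : InSigmaM R M X :=
  ⟨ι →₀ M, inferInstance, inferInstance, ⟨ι, LinearMap.id, Function.surjective_id⟩, g, hg⟩

theorem inSigmaM_submodule_s11 (K : Submodule R M) : InSigmaM R M K :=
  inSigmaM_of_injective (Finsupp.lsingle PUnit.unit ∘ₗ K.subtype)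
    ((Finsupp.single_injective _).comp K.injective_subtype)

theorem inSigmaM_finsupp_submodule (ι : Type v) (K : Submodule R M) :
    InSigmaM R M (ι →₀ K) :=
  inSigmaM_of_injective (Finsupp.mapRange.linearMap K.subtype)
    (Finsupp.mapRange_injective _ (map_zero _) K.injective_subtype)

theorem annM_fullyInvariantHull (hproj : ProjectiveInSigmaM R M) (K : Submodule R M) :
    annM R M (fullyInvariantHull K) = annM R M K := by
  refine le_antisymm (annM_anti (le_fullyInvariantHull K)) fun x hx => mem_annM.2 fun f hf => ?_
  let φ : ((M →ₗ[R] M) →₀ K) →ₗ[R] M := Finsupp.lsum ℕ fun g => g ∘ₗ K.subtype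
  have hφ : fullyInvariantHull K ≤ LinearMap.range φ := by
    refine iSup_le fun g => ?_
    rintro _ ⟨k, hk, rfl⟩
    exact ⟨Finsupp.single g ⟨k, hk⟩, by simp [φ]⟩
  obtain ⟨F, hF⟩ := hproj _ _ (inSigmaM_finsupp_submodule _ K) (inSigmaM_submodule_s11 _)
    φ.rangeRestrict φ.surjective_rangeRestrict
    (f.codRestrict (LinearMap.range φ) fun y => hφ (hf ⟨y, rfl⟩))
  have hFx : F x = 0 := by
    ext g
    refine mem_annM.1 hx (K.subtype ∘ₗ Finsupp.lapply g ∘ₗ F) ?_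
    rintro _ ⟨y, rfl⟩
    exact (F y g).2
  have h := congrArg Subtype.val (LinearMap.congr_fun hF x)
  simpa [hFx] using h.symm

theorem IsAnnihilatorSub.exists_isFullyInvariant (hproj : ProjectiveInSigmaM R M)
    {N : Submodule R M} (hN : IsAnnihilatorSub R M N) :
    ∃ K : Submodule R M, IsFullyInvariant R M K ∧ K ≠ ⊥ ∧ N = annM R M K := by
  obtain ⟨K, hK, rfl⟩ := hN
  exact ⟨fullyInvariantHull K, isFullyInvariant_fullyInvariantHull K,
    fun h => hK (le_bot_iff.1 (h ▸ le_fullyInvariantHull K)),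
    (annM_fullyInvariantHull hproj K).symm⟩

/-- A prime submodule contained in the annihilator of a nonzero fully invariant submodule
contains that annihilator. -/
theorem IsPrimeSubmodule.annM_le (hsemi : IsSemiprimeModule R M) {P K : Submodule R M}
    (hP : IsPrimeSubmodule R M P) (hK : IsFullyInvariant R M K) (hK0 : K ≠ ⊥)
    (hPK : P ≤ annM R M K) : annM R M K ≤ P := by
  refine (hP.2 _ K (isFullyInvariant_annM K) hK
    ((prodM_eq_bot_iff.2 le_rfl).le.trans bot_le)).resolve_right fun h => hK0 ?_
  simpa using hsemi.inf_eq_bot hK hK (h.trans hPK)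

theorem isPrimeSubmodule_of_maximal_annihilator (hproj : ProjectiveInSigmaM R M)
    (hsemi : IsSemiprimeModule R M) {N : Submodule R M} (hN : IsAnnihilatorSub R M N)
    (hmax : ∀ L : Submodule R M, IsAnnihilatorSub R M L → N ≤ L → L = N) :
    IsPrimeSubmodule R M N := by
  obtain ⟨K, hK, -, rfl⟩ := hN.exists_isFullyInvariant hproj
  refine ⟨isFullyInvariant_annM K, fun A B hA hB hAB => or_iff_not_imp_right.2 fun hBK => ?_⟩
  have hne : B ⊓ K ≠ ⊥ := fun h =>
    hBK (prodM_eq_bot_iff.1 (le_bot_iff.1 ((prodM_le_inf hB).trans h.le)))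
  rw [← hmax _ ⟨B ⊓ K, hne, rfl⟩ (annM_anti inf_le_right), ← prodM_eq_bot_iff, ← le_bot_iff,
    ← hsemi.inf_eq_bot hB.prodM hK hAB]
  exact le_inf (prodM_mono le_rfl inf_le_left) ((prodM_le_inf hA).trans
    (inf_le_right.trans inf_le_right))

end Annihilators

/-- For `M` projective in `σ[M]` and semiprime and `N ≤ M`:
(a) `N` is a maximal annihilator submodule iff (b) `N` is an annihilator submodule and a
minimal prime submodule iff (c) `N` is prime and an annihilator submodule. -/
theorem stmt11 (R : Type u) [Ring R] (M : Type v) [AddCommGroup M] [Module R M]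
    (hproj : ProjectiveInSigmaM R M) (hsemi : IsSemiprimeModule R M)
    (N : Submodule R M) :
    ((IsAnnihilatorSub R M N ∧
        ∀ L : Submodule R M, IsAnnihilatorSub R M L → N ≤ L → L = N) ↔
      (IsAnnihilatorSub R M N ∧ IsMinimalPrimeSubmodule R M N)) ∧
    ((IsAnnihilatorSub R M N ∧ IsMinimalPrimeSubmodule R M N) ↔
      (IsPrimeSubmodule R M N ∧ IsAnnihilatorSub R M N)) := by
  have minimal_of_prime (hP : IsPrimeSubmodule R M N) (hN : IsAnnihilatorSub R M N) :
      IsMinimalPrimeSubmodule R M N := by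
    obtain ⟨K, hK, hK0, rfl⟩ := hN.exists_isFullyInvariant hproj
    exact ⟨hP, fun Q hQ hle => le_antisymm hle (hQ.annM_le hsemi hK hK0 hle)⟩
  refine ⟨⟨fun h => ⟨h.1, minimal_of_prime
      (isPrimeSubmodule_of_maximal_annihilator hproj hsemi h.1 h.2) h.1⟩, ?_⟩,
    fun h => ⟨h.2.1, h.1⟩, fun h => ⟨h.2, minimal_of_prime h.1 h.2⟩⟩
  rintro ⟨hN, hP, -⟩
  refine ⟨hN, fun L hL hle => le_antisymm ?_ hle⟩
  obtain ⟨H, hH, hH0, rfl⟩ := hL.exists_isFullyInvariant hproj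
  exact hP.annM_le hsemi hH hH0 hle
end
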